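/- Let n ≥ 2 and let X ⊆ (0,∞). Then X has Property (W_n) if and only if X is closed under the two operations (x,y) ↦ x+y and (x,y,z) ↦ x+y+z−2·min(x,y,z), i.e. for all x,y ∈ X one has x+y ∈ X, and for all x,y,z ∈ X one has x+y+z−2·min(x,y,z) ∈ X. -/

import Mathlib

open BoxIntegral

/-- The (closed) set of points of an `n`-dimensional box. -/
def boxSet {n : ℕ} (B : Box (Fin n)) : Set (Fin n → ℝ) :=
  Set.Icc B.lower B.upper

/-- The box `B` has a side whose length belongs to `X`. -/
def hasSideIn {n : ℕ} (X : Set ℝ) (B : Box (Fin n)) : Prop :=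
  ∃ i : Fin n, B.upper i - B.lower i ∈ X

/-- `Q` is a partition of `P`: a finite collection of boxes with pairwise disjoint
interiors whose union is `P`. -/
def isBoxPartition {n k : ℕ} (P : Box (Fin n)) (Q : Fin k → Box (Fin n)) : Prop :=
  (∀ j j' : Fin k, j ≠ j' →
    Disjoint (interior (boxSet (Q j))) (interior (boxSet (Q j')))) ∧
  (⋃ j, boxSet (Q j)) = boxSet P

/-- Property (W_n): for every `n`-dimensional box `P` and every partition of `P`
such that each constituent box has a side with length in `X`, the box `P` itself
has a side with length in `X`. -/
def PropertyW (n : ℕ) (X : Set ℝ) : Prop :=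
  ∀ (P : Box (Fin n)) (k : ℕ) (Q : Fin k → Box (Fin n)),
    isBoxPartition P Q → (∀ j, hasSideIn X (Q j)) → hasSideIn X P


/-- A path of `m` steps from `a` to `c` inside `[a, b]` with step lengths in `X`. -/
def IsXPath (X : Set ℝ) (a b c : ℝ) (m : ℕ) (x : ℕ → ℝ) : Prop :=
  x 0 = a ∧ x m = c ∧ (∀ j ≤ m, a ≤ x j ∧ x j ≤ b) ∧ ∀ j < m, |x (j + 1) - x j| ∈ X

/-- Reachability of `c` from `a` inside `[a, b]`. -/
def XReach (X : Set ℝ) (a b c : ℝ) : Prop := ∃ m x, IsXPath X a b c m x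

lemma XReach.step {X : Set ℝ} {a b c d : ℝ} (h : XReach X a b c) (hd : a ≤ d ∧ d ≤ b)
    (hs : |d - c| ∈ X) : XReach X a b d := by
  obtain ⟨m, x, h0, hm, hb, hx⟩ := h
  refine ⟨m + 1, fun j => if j ≤ m then x j else d, by simp [h0], by simp, ?_, ?_⟩
  · intro j hj
    by_cases h : j ≤ m
    · simpa [h] using hb j h
    · simpa [h] using hd
  · intro j hj
    by_cases h : j < m
    · have h1 : j + 1 ≤ m := h
      simpa [h1, h.le] using hx j h
    · have : j = m := by omega
      subst this
      simpa [hm] using hs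

/-- Deleting `d` interior vertices of a path. -/
lemma IsXPath.delete {X : Set ℝ} {a b c : ℝ} {m : ℕ} {x : ℕ → ℝ} (h : IsXPath X a b c m x)
    (i d : ℕ) (hid : i + 1 + d ≤ m) (hs : |x (i + 1 + d) - x i| ∈ X) :
    ∃ y, IsXPath X a b c (m - d) y := by
  obtain ⟨h0, hm, hb, hx⟩ := h
  refine ⟨fun j => if j ≤ i then x j else x (j + d), by simp [h0], ?_, ?_, ?_⟩
  · have h1 : ¬ (m - d ≤ i) := by omega
    have h2 : m - d + d = m := by omega
    simp [h1, h2, hm]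
  · intro j hj
    by_cases h : j ≤ i
    · simpa [h] using hb j (by omega)
    · simpa [h] using hb (j + d) (by omega)
  · intro j hj
    rcases lt_trichotomy j i with h | h | h
    · have h1 : j + 1 ≤ i := h
      simpa [h1, h.le] using hx j (by omega)
    · subst h
      simpa using hs
    · have h1 : ¬ (j ≤ i) := by omega
      have h2 : ¬ (j + 1 ≤ i) := by omega
      have h3 : j + 1 + d = j + d + 1 := by omega
      simpa [h1, h2, h3] using hx (j + d) (by omega)

lemma IsXPath.shift {X : Set ℝ} {a b c : ℝ} {m : ℕ} {x : ℕ → ℝ} (h : IsXPath X a b c m x)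
    (d : ℕ) (hd : d ≤ m) (hs : x d = a) :
    ∃ y, IsXPath X a b c (m - d) y := by
  obtain ⟨h0, hm, hb, hx⟩ := h
  refine ⟨fun j => x (j + d), by simp [hs], ?_, ?_, ?_⟩
  · have h2 : m - d + d = m := by omega
    simp [h2, hm]
  · intro j hj
    exact hb (j + d) (by omega)
  · intro j hj
    have h3 : j + 1 + d = j + d + 1 := by omega
    simpa [h3] using hx (j + d) (by omega)

lemma IsXPath.trunc {X : Set ℝ} {a b c : ℝ} {m : ℕ} {x : ℕ → ℝ} (h : IsXPath X a b c m x)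
    (d : ℕ) (hs : x (m - d) = c) : IsXPath X a b c (m - d) x := by
  obtain ⟨h0, hm, hb, hx⟩ := h
  exact ⟨h0, hs, fun j hj => hb j (by omega), fun j hj => hx j (by omega)⟩

lemma path_mem {X : Set ℝ} (hX : X ⊆ Set.Ioi 0)
    (hadd : ∀ x ∈ X, ∀ y ∈ X, x + y ∈ X)
    (htri : ∀ x ∈ X, ∀ y ∈ X, ∀ z ∈ X, x + y + z - 2 * min x (min y z) ∈ X)
    {a b : ℝ} (hab : a < b) : ∀ (m : ℕ) (x : ℕ → ℝ), IsXPath X a b b m x → b - a ∈ X := by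
  intro m
  induction m using Nat.strong_induction_on with
  | _ m ih =>
  intro x hp
  have hp' := hp
  obtain ⟨h0, hm, hb, hx⟩ := hp'
  have hm0 : m ≠ 0 := by
    rintro rfl
    linarith
  by_cases hm1 : m = 1
  · subst hm1
    have := hx 0 (by norm_num)
    rw [zero_add, hm, h0, abs_of_pos (by linarith)] at this
    exact this
  -- merging two consecutive steps of the same sign
  have merge : ∀ i, i + 2 ≤ m → 0 < (x (i + 1) - x i) * (x (i + 2) - x (i + 1)) → b - a ∈ X := by
    intro i hi hpos
    have h1 := hx i (by omega)
    have h2 := hx (i + 1) (by omega)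
    have h3 := hadd _ h1 _ h2
    have : |x (i + 1 + 1) - x i| ∈ X := by
      convert h3 using 1
      rcases pos_and_pos_or_neg_and_neg_of_mul_pos hpos with ⟨p, q⟩ | ⟨p, q⟩
      · rw [abs_of_pos p, abs_of_pos q, abs_of_pos (by linarith)]; ring
      · rw [abs_of_neg p, abs_of_neg q, abs_of_neg (by linarith)]; ring
    obtain ⟨y, hy⟩ := hp.delete i 1 (by omega) this
    exact ih (m - 1) (by omega) y hy
  have hne : ∀ i < m, x (i + 1) - x i ≠ 0 := by
    intro i hi h
    have := hX (hx i hi)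
    simp [h] at this
  have alt : (∀ i, i + 2 ≤ m → (x (i + 1) - x i) * (x (i + 2) - x (i + 1)) < 0) ∨ b - a ∈ X := by
    by_cases h : b - a ∈ X
    · exact Or.inr h
    · left
      intro i hi
      by_contra hcon
      have := mul_ne_zero (hne i (by omega)) (hne (i + 1) (by omega))
      exact h (merge i hi (lt_of_le_of_ne (not_lt.1 hcon) this.symm))
  rcases alt with alt | h
  swap
  · exact h
  obtain ⟨i, hi, hmin⟩ := Finset.exists_min_image (Finset.range m) (fun i => |x (i + 1) - x i|)
    ⟨0, by simp; omega⟩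
  simp only [Finset.mem_range] at hi hmin
  by_cases hi0 : i = 0
  · subst hi0
    have h1 := alt 0 (by omega)
    have h2 := hmin 1 (by omega)
    have h3 := hb 1 (by omega)
    have h4 := hb 2 (by omega)
    have h5 := hne 0 (by omega)
    simp only [zero_add, one_add_one_eq_two] at h1 h2 h5
    have hp1 : 0 < x 1 - x 0 := lt_of_le_of_ne (by linarith) h5.symm
    have hn1 : x 2 - x 1 < 0 := by
      by_contra hcon
      nlinarith [mul_nonneg hp1.le (not_lt.1 hcon)]
    rw [abs_of_pos hp1, abs_of_neg hn1] at h2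
    have h6 : x 2 = a := by linarith
    obtain ⟨y, hy⟩ := hp.shift 2 (by omega) h6
    exact ih (m - 2) (by omega) y hy
  by_cases him : i + 1 = m
  · obtain ⟨k, rfl⟩ : ∃ k, i = k + 1 := ⟨i - 1, by omega⟩
    have h1 := alt k (by omega)
    have h2 := hmin k (by omega)
    have h3 := hb (k + 1) (by omega)
    have h4 := hb k (by omega)
    have h5 := hne (k + 1) (by omega)
    have hm' : x (k + 2) = b := by rw [← hm, ← him]
    simp only [add_assoc, one_add_one_eq_two] at h1 h2 h5
    have hp1 : 0 < x (k + 2) - x (k + 1) := lt_of_le_of_ne (by linarith) h5.symm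
    have hn1 : x (k + 1) - x k < 0 := by
      by_contra hcon
      nlinarith [mul_nonneg hp1.le (not_lt.1 hcon)]
    rw [abs_of_pos hp1, abs_of_neg hn1] at h2
    have h6 : x k = b := by linarith
    have hk : m - 2 = k := by omega
    exact ih (m - 2) (by omega) x (hp.trunc 2 (by rw [hk, h6]))
  · obtain ⟨k, rfl⟩ : ∃ k, i = k + 1 := ⟨i - 1, by omega⟩
    have h1 := alt k (by omega)
    have h2 := hmin k (by omega)
    have h3 := alt (k + 1) (by omega)
    have h4 := hmin (k + 2) (by omega)
    have g1 := hx k (by omega)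
    have g2 := hx (k + 1) (by omega)
    have g3 := hx (k + 2) (by omega)
    have h5 := htri _ g1 _ g2 _ g3
    simp only [add_assoc, Nat.reduceAdd] at h1 h2 h3 h4 g1 g2 g3 h5
    rw [min_eq_left h4, min_eq_right h2] at h5
    have : |x (k + 1 + 2) - x k| ∈ X := by
      convert h5 using 1
      simp only [add_assoc, Nat.reduceAdd]
      rcases mul_neg_iff.1 h1 with ⟨p, q⟩ | ⟨p, q⟩ <;> rcases mul_neg_iff.1 h3 with ⟨r, s⟩ | ⟨r, s⟩
      · linarith
      · rw [abs_of_neg q, abs_of_pos p] at h2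
        rw [abs_of_pos p, abs_of_neg r, abs_of_pos s, abs_of_pos (by linarith)]; ring
      · rw [abs_of_pos q, abs_of_neg p] at h2
        rw [abs_of_neg p, abs_of_pos r, abs_of_neg s, abs_of_neg (by linarith)]; ring
      · linarith
    obtain ⟨y, hy⟩ := hp.delete k 2 (by omega) this
    exact ih (m - 2) (by omega) y hy

/-- Product-type box additive function. -/
noncomputable def prodAdd {n : ℕ} (f : Fin n → ℝ → ℝ) : BoxAdditiveMap (Fin n) ℝ ⊤ :=
  BoxAdditiveMap.ofMapSplitAdd (fun B => ∏ i, (f i (B.upper i) - f i (B.lower i))) ⊤ (by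
    intro I _ i x hx
    rw [Box.splitLower_def hx, Box.splitUpper_def hx]
    change (∏ j, (f j (Function.update I.upper i x j) - f j (I.lower j))) +
      (∏ j, (f j (I.upper j) - f j (Function.update I.lower i x j))) = _
    rw [← Finset.mul_prod_erase _ _ (Finset.mem_univ i),
      ← Finset.mul_prod_erase Finset.univ (fun j => f j (I.upper j) -
        f j (Function.update I.lower i x j)) (Finset.mem_univ i),
      ← Finset.mul_prod_erase Finset.univ (fun j => f j (I.upper j) -
        f j (I.lower j)) (Finset.mem_univ i)]
    have e1 : ∏ j ∈ Finset.univ.erase i, (f j (Function.update I.upper i x j) - f j (I.lower j))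
        = ∏ j ∈ Finset.univ.erase i, (f j (I.upper j) - f j (I.lower j)) := by
      refine Finset.prod_congr rfl fun j hj => ?_
      rw [Function.update_of_ne (Finset.ne_of_mem_erase hj)]
    have e2 : ∏ j ∈ Finset.univ.erase i, (f j (I.upper j) - f j (Function.update I.lower i x j))
        = ∏ j ∈ Finset.univ.erase i, (f j (I.upper j) - f j (I.lower j)) := by
      refine Finset.prod_congr rfl fun j hj => ?_
      rw [Function.update_of_ne (Finset.ne_of_mem_erase hj)]
    rw [e1, e2]
    simp only [Function.update_self]
    ring)

lemma prodAdd_apply {n : ℕ} (f : Fin n → ℝ → ℝ) (B : Box (Fin n)) :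
    prodAdd f B = ∏ i, (f i (B.upper i) - f i (B.lower i)) := rfl

lemma mem_interior_boxSet {n : ℕ} (B : Box (Fin n)) (x : Fin n → ℝ) :
    x ∈ interior (boxSet B) ↔ ∀ i, B.lower i < x i ∧ x i < B.upper i := by
  rw [boxSet, ← Set.pi_univ_Icc, interior_pi_set Set.finite_univ]
  simp [interior_Icc]

lemma box_sub {n k : ℕ} {P : Box (Fin n)} {Q : Fin k → Box (Fin n)} (h : isBoxPartition P Q)
    (j : Fin k) : Q j ≤ P := by
  rw [Box.le_iff_Icc]
  have : boxSet (Q j) ⊆ boxSet P := by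
    rw [← h.2]
    exact Set.subset_iUnion (fun j => boxSet (Q j)) j
  exact this

lemma sum_partition {n k : ℕ} {P : Box (Fin n)} {Q : Fin k → Box (Fin n)}
    (h : isBoxPartition P Q) (F : BoxAdditiveMap (Fin n) ℝ ⊤) (hF : ∀ j, F (Q j) = 0) :
    F P = 0 := by
  classical
  let π : Prepartition P :=
    { boxes := Finset.univ.image Q
      le_of_mem' := by
        intro J hJ
        obtain ⟨j, -, rfl⟩ := Finset.mem_image.1 hJ
        exact box_sub h j
      pairwiseDisjoint := by
        intro J hJ J' hJ' hne
        obtain ⟨j, -, rfl⟩ := Finset.mem_image.1 (Finset.mem_coe.1 hJ)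
        obtain ⟨j', -, rfl⟩ := Finset.mem_image.1 (Finset.mem_coe.1 hJ')
        have hjj : j ≠ j' := fun e => hne (by rw [e])
        have hd := h.1 j j' hjj
        change Disjoint ((Q j : Set (Fin n → ℝ))) (Q j')
        rw [Set.disjoint_left] at hd ⊢
        intro x hx hx'
        let y : Fin n → ℝ := fun i => (max ((Q j).lower i) ((Q j').lower i) + x i) / 2
        have hy : ∀ i, max ((Q j).lower i) ((Q j').lower i) < y i ∧ y i < x i := by
          intro i
          have h1 := (hx i).1
          have h2 := (hx' i).1
          have h3 : max ((Q j).lower i) ((Q j').lower i) < x i := max_lt h1 h2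
          simp only [y]
          constructor <;> linarith
        apply hd (a := y)
        · rw [mem_interior_boxSet]
          intro i
          exact ⟨(le_max_left _ _).trans_lt (hy i).1, (hy i).2.trans_le (hx i).2⟩
        · rw [mem_interior_boxSet]
          intro i
          exact ⟨(le_max_right _ _).trans_lt (hy i).1, (hy i).2.trans_le (hx' i).2⟩ }
  have hπ : π.IsPartition := by
    intro x hx
    -- points slightly below `x`
    have hev : ∀ᶠ ε in nhdsWithin (0 : ℝ) (Set.Ioi 0), ∃ j, (fun i => x i - ε) ∈ boxSet (Q j) := by
      have h1 : ∀ᶠ ε in nhdsWithin (0 : ℝ) (Set.Ioi 0), ∀ i, ε < x i - P.lower i := by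
        rw [Filter.eventually_all]
        intro i
        exact nhdsWithin_le_nhds (eventually_lt_nhds (by linarith [(hx i).1]))
      filter_upwards [h1, self_mem_nhdsWithin] with ε he hpos
      have : (fun i => x i - ε) ∈ ⋃ j, boxSet (Q j) := by
        rw [h.2]
        have hpos' : (0 : ℝ) < ε := hpos
        exact ⟨fun i => by have := he i; simp only; linarith,
          fun i => by have := (hx i).2; simp only; linarith⟩
      simpa using this
    have hfr := hev.frequently
    rw [Filter.frequently_exists] at hfr
    obtain ⟨j, hj⟩ := hfr
    refine ⟨Q j, Finset.mem_image_of_mem _ (Finset.mem_univ j), fun i => ⟨?_, ?_⟩⟩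
    · obtain ⟨ε, he, hpos⟩ := (hj.and_eventually self_mem_nhdsWithin).exists
      have h1 : (Q j).lower i ≤ x i - ε := he.1 i
      have hpos' : (0 : ℝ) < ε := hpos
      linarith
    · by_contra hcon
      have h1 : ∀ᶠ ε in nhdsWithin (0 : ℝ) (Set.Ioi 0), ε < x i - (Q j).upper i :=
        nhdsWithin_le_nhds (eventually_lt_nhds (by linarith))
      obtain ⟨ε, he, hlt⟩ := (hj.and_eventually h1).exists
      have h1 : x i - ε ≤ (Q j).upper i := he.2 i
      linarith
  rw [← F.sum_partition_boxes le_top hπ]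
  apply Finset.sum_eq_zero
  intro J hJ
  obtain ⟨j, -, rfl⟩ := Finset.mem_image.1 hJ
  exact hF j

lemma propertyW_of_closed {n : ℕ} {X : Set ℝ} (hX : X ⊆ Set.Ioi 0)
    (hadd : ∀ x ∈ X, ∀ y ∈ X, x + y ∈ X)
    (htri : ∀ x ∈ X, ∀ y ∈ X, ∀ z ∈ X, x + y + z - 2 * min x (min y z) ∈ X) :
    PropertyW n X := by
  classical
  intro P k Q hQ hs
  by_contra hcon
  let f : Fin n → ℝ → ℝ := fun i c => if XReach X (P.lower i) (P.upper i) c then 1 else 0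
  have hP := sum_partition hQ (prodAdd f) (by
    intro j
    obtain ⟨i, hi⟩ := hs j
    rw [prodAdd_apply]
    refine Finset.prod_eq_zero (Finset.mem_univ i) ?_
    have hsub := Box.le_iff_bounds.1 (box_sub hQ j)
    have h1 : P.lower i ≤ (Q j).lower i := hsub.1 i
    have h2 : (Q j).upper i ≤ P.upper i := hsub.2 i
    have h3 := (Q j).lower_lt_upper i
    have hiff : XReach X (P.lower i) (P.upper i) ((Q j).upper i) ↔
        XReach X (P.lower i) (P.upper i) ((Q j).lower i) := by
      constructor
      · intro h
        refine h.step ⟨h1, by linarith⟩ ?_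
        rw [abs_sub_comm, abs_of_pos (by linarith)]
        exact hi
      · intro h
        refine h.step ⟨by linarith, h2⟩ ?_
        rw [abs_of_pos (by linarith)]
        exact hi
    simp only [f, hiff, sub_self])
  rw [prodAdd_apply, Finset.prod_eq_zero_iff] at hP
  obtain ⟨i, -, hi⟩ := hP
  have hlt := P.lower_lt_upper i
  have hl : XReach X (P.lower i) (P.upper i) (P.lower i) :=
    ⟨0, fun _ => P.lower i, rfl, rfl, fun _ _ => ⟨le_rfl, hlt.le⟩, by simp⟩
  have hu : XReach X (P.lower i) (P.upper i) (P.upper i) := by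
    by_contra hu
    simp [f, hl, hu] at hi
  obtain ⟨m, x, hx⟩ := hu
  exact hcon ⟨i, path_mem hX hadd htri hlt m x hx⟩

/-- The box `[a,b] × [c,d] × [0,w]^(n-2)`. -/
def rectBox {n : ℕ} (hn : 2 ≤ n) (w a b c d : ℝ) (hw : 0 < w) (hab : a < b) (hcd : c < d) :
    Box (Fin n) where
  lower := fun i => if i = ⟨0, by omega⟩ then a else if i = ⟨1, by omega⟩ then c else 0
  upper := fun i => if i = ⟨0, by omega⟩ then b else if i = ⟨1, by omega⟩ then d else w
  lower_lt_upper := by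
    intro i
    split_ifs <;> assumption

lemma mem_rectBox {n : ℕ} (hn : 2 ≤ n) (w a b c d : ℝ) (hw : 0 < w) (hab : a < b) (hcd : c < d)
    (x : Fin n → ℝ) :
    x ∈ boxSet (rectBox hn w a b c d hw hab hcd) ↔
      (a ≤ x ⟨0, by omega⟩ ∧ x ⟨0, by omega⟩ ≤ b) ∧ (c ≤ x ⟨1, by omega⟩ ∧ x ⟨1, by omega⟩ ≤ d) ∧
      ∀ i : Fin n, i ≠ ⟨0, by omega⟩ → i ≠ ⟨1, by omega⟩ → 0 ≤ x i ∧ x i ≤ w := by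
  constructor
  · rintro ⟨h1, h2⟩
    refine ⟨⟨?_, ?_⟩, ⟨?_, ?_⟩, fun i hi0 hi1 => ⟨?_, ?_⟩⟩
    · simpa [rectBox] using h1 ⟨0, by omega⟩
    · simpa [rectBox] using h2 ⟨0, by omega⟩
    · have e : (rectBox hn w a b c d hw hab hcd).lower ⟨1, by omega⟩ = c := by simp [rectBox]
      exact e.symm.le.trans (h1 _)
    · have e : (rectBox hn w a b c d hw hab hcd).upper ⟨1, by omega⟩ = d := by simp [rectBox]
      exact (h2 _).trans e.le
    · simpa [rectBox, hi0, hi1] using h1 i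
    · simpa [rectBox, hi0, hi1] using h2 i
  · rintro ⟨h0, h1, h2⟩
    constructor <;> intro i <;> simp only [rectBox] <;> split_ifs with e0 e1
    · subst e0; exact h0.1
    · subst e1; exact h1.1
    · exact (h2 i e0 e1).1
    · subst e0; exact h0.2
    · subst e1; exact h1.2
    · exact (h2 i e0 e1).2

lemma interior_rectBox {n : ℕ} (hn : 2 ≤ n) (w a b c d : ℝ) (hw : 0 < w) (hab : a < b)
    (hcd : c < d) (x : Fin n → ℝ) (h : x ∈ interior (boxSet (rectBox hn w a b c d hw hab hcd))) :
      (a < x ⟨0, by omega⟩ ∧ x ⟨0, by omega⟩ < b) ∧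
      (c < x ⟨1, by omega⟩ ∧ x ⟨1, by omega⟩ < d) := by
  rw [mem_interior_boxSet] at h
  have h0 := h ⟨0, by omega⟩
  have h1 := h ⟨1, by omega⟩
  simp [rectBox] at h0 h1
  exact ⟨h0, h1⟩

lemma hasSide_rectBox_left {n : ℕ} (hn : 2 ≤ n) (w a b c d : ℝ) (hw : 0 < w) (hab : a < b)
    (hcd : c < d) {X : Set ℝ} (h : b - a ∈ X) :
    hasSideIn X (rectBox hn w a b c d hw hab hcd) :=
  ⟨⟨0, by omega⟩, by simpa [rectBox] using h⟩

lemma hasSide_rectBox_right {n : ℕ} (hn : 2 ≤ n) (w a b c d : ℝ) (hw : 0 < w) (hab : a < b)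
    (hcd : c < d) {X : Set ℝ} (h : d - c ∈ X) :
    hasSideIn X (rectBox hn w a b c d hw hab hcd) :=
  ⟨⟨1, by omega⟩, by simpa [rectBox] using h⟩

lemma hasSide_cube {n : ℕ} (hn : 2 ≤ n) (w : ℝ) (hw : 0 < w) {X : Set ℝ}
    (h : hasSideIn X (rectBox hn w 0 w 0 w hw hw hw)) : w ∈ X := by
  obtain ⟨i, hi⟩ := h
  simp only [rectBox] at hi
  split_ifs at hi <;> simpa using hi

lemma add_mem_of_W {n : ℕ} (hn : 2 ≤ n) {X : Set ℝ} (hX : X ⊆ Set.Ioi 0) (hW : PropertyW n X)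
    {x y : ℝ} (hx : x ∈ X) (hy : y ∈ X) : x + y ∈ X := by
  have hx0 : 0 < x := hX hx
  have hy0 : 0 < y := hX hy
  have hw : 0 < x + y := by linarith
  apply hasSide_cube hn (x + y) hw
  refine hW _ 2 ![rectBox hn (x + y) 0 x 0 (x + y) hw hx0 hw,
    rectBox hn (x + y) x (x + y) 0 (x + y) hw (by linarith) hw] ⟨?_, ?_⟩ ?_
  · intro j j' hne
    rw [Set.disjoint_left]
    intro p hp hp'
    fin_cases j <;> fin_cases j' <;> first
      | exact hne rfl
      | (have h1 := interior_rectBox hn _ _ _ _ _ hw (by linarith) (by linarith) _ hp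
         have h2 := interior_rectBox hn _ _ _ _ _ hw (by linarith) (by linarith) _ hp'
         linarith [h1.1.1, h1.1.2, h2.1.1, h2.1.2])
  · ext p
    simp only [Set.mem_iUnion, Fin.exists_fin_two, Matrix.cons_val_zero, Matrix.cons_val_one,
      mem_rectBox]
    constructor
    · rintro (⟨h1, h2, h3⟩ | ⟨h1, h2, h3⟩)
      · exact ⟨⟨by linarith [h1.1], by linarith [h1.2]⟩, h2, h3⟩
      · exact ⟨⟨by linarith [h1.1], by linarith [h1.2]⟩, h2, h3⟩
    · rintro ⟨h1, h2, h3⟩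
      rcases le_total (p ⟨0, by omega⟩) x with h | h
      · exact Or.inl ⟨⟨h1.1, h⟩, h2, h3⟩
      · exact Or.inr ⟨⟨h, h1.2⟩, h2, h3⟩
  · rw [Fin.forall_fin_two]
    exact ⟨hasSide_rectBox_left hn _ _ _ _ _ hw (by linarith) (by linarith) (by simpa using hx),
      hasSide_rectBox_left hn _ _ _ _ _ hw (by linarith) (by linarith) (by simpa using hy)⟩

lemma pinwheel_mem_of_W {n : ℕ} (hn : 2 ≤ n) {X : Set ℝ} (hX : X ⊆ Set.Ioi 0)
    (hW : PropertyW n X) {x y z : ℝ} (hx : x ∈ X) (hy : y ∈ X) (hz : z ∈ X)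
    (hzx : z ≤ x) (hzy : z ≤ y) : x + y - z ∈ X := by
  rcases hzx.eq_or_lt with rfl | hzx
  · simpa using hy
  rcases hzy.eq_or_lt with rfl | hzy
  · simpa using hx
  have hz0 : 0 < z := hX hz
  obtain ⟨w, hwd⟩ : ∃ w, w = x + y - z := ⟨_, rfl⟩
  rw [← hwd]
  have hw : 0 < w := by linarith
  apply hasSide_cube hn w hw
  refine hW _ 5 ![rectBox hn w 0 x 0 (x - z) hw (by linarith) (by linarith),
    rectBox hn w x w 0 x hw (by linarith) (by linarith),
    rectBox hn w (x - z) w x w hw (by linarith) (by linarith),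
    rectBox hn w 0 (x - z) (x - z) w hw (by linarith) (by linarith),
    rectBox hn w (x - z) x (x - z) x hw (by linarith) (by linarith)] ⟨?_, ?_⟩ ?_
  · intro j j' hne
    rw [Set.disjoint_left]
    intro p hp hp'
    fin_cases j <;> fin_cases j' <;> first
      | exact hne rfl
      | (have h1 := interior_rectBox hn _ _ _ _ _ hw (by linarith) (by linarith) _ hp
         have h2 := interior_rectBox hn _ _ _ _ _ hw (by linarith) (by linarith) _ hp'
         linarith [h1.1.1, h1.1.2, h2.1.1, h2.1.2, h1.2.1, h1.2.2, h2.2.1, h2.2.2])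
  · ext p
    constructor
    · intro hp
      obtain ⟨j, hj⟩ := Set.mem_iUnion.1 hp
      rw [mem_rectBox]
      fin_cases j <;>
      · obtain ⟨⟨h1, h2⟩, ⟨h3, h4⟩, h5⟩ := (mem_rectBox hn _ _ _ _ _ hw (by linarith) (by linarith) _).1 hj
        exact ⟨⟨by linarith, by linarith⟩, ⟨by linarith, by linarith⟩, h5⟩
    · rw [mem_rectBox, Set.mem_iUnion]
      rintro ⟨⟨h1, h2⟩, ⟨h3, h4⟩, h5⟩
      rcases le_total (p ⟨1, by omega⟩) (x - z) with hb | hb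
      · rcases le_total (p ⟨0, by omega⟩) x with ha | ha
        · exact ⟨0, (mem_rectBox hn _ _ _ _ _ hw (by linarith) (by linarith) _).2
            ⟨⟨by linarith, by linarith⟩, ⟨by linarith, by linarith⟩, h5⟩⟩
        · exact ⟨1, (mem_rectBox hn _ _ _ _ _ hw (by linarith) (by linarith) _).2
            ⟨⟨by linarith, by linarith⟩, ⟨by linarith, by linarith⟩, h5⟩⟩
      · rcases le_total (p ⟨0, by omega⟩) (x - z) with ha | ha
        · exact ⟨3, (mem_rectBox hn _ _ _ _ _ hw (by linarith) (by linarith) _).2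
            ⟨⟨by linarith, by linarith⟩, ⟨by linarith, by linarith⟩, h5⟩⟩
        · rcases le_total (p ⟨1, by omega⟩) x with hc | hc
          · rcases le_total (p ⟨0, by omega⟩) x with hd | hd
            · exact ⟨4, (mem_rectBox hn _ _ _ _ _ hw (by linarith) (by linarith) _).2
                ⟨⟨by linarith, by linarith⟩, ⟨by linarith, by linarith⟩, h5⟩⟩
            · exact ⟨1, (mem_rectBox hn _ _ _ _ _ hw (by linarith) (by linarith) _).2
                ⟨⟨by linarith, by linarith⟩, ⟨by linarith, by linarith⟩, h5⟩⟩
          · exact ⟨2, (mem_rectBox hn _ _ _ _ _ hw (by linarith) (by linarith) _).2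
              ⟨⟨by linarith, by linarith⟩, ⟨by linarith, by linarith⟩, h5⟩⟩
  · intro j
    fin_cases j
    · exact hasSide_rectBox_left hn _ _ _ _ _ hw (by linarith) (by linarith) (by simpa using hx)
    · exact hasSide_rectBox_right hn _ _ _ _ _ hw (by linarith) (by linarith) (by simpa using hx)
    · refine hasSide_rectBox_left hn _ _ _ _ _ hw (by linarith) (by linarith) ?_
      convert hy using 1; linarith
    · refine hasSide_rectBox_right hn _ _ _ _ _ hw (by linarith) (by linarith) ?_
      convert hy using 1; linarith
    · exact hasSide_rectBox_left hn _ _ _ _ _ hw (by linarith) (by linarith) (by simpa using hz)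

theorem propertyW_iff_closed (n : ℕ) (hn : 2 ≤ n) (X : Set ℝ) (hX : X ⊆ Set.Ioi 0) :
    PropertyW n X ↔
      ((∀ x ∈ X, ∀ y ∈ X, x + y ∈ X) ∧
       (∀ x ∈ X, ∀ y ∈ X, ∀ z ∈ X, x + y + z - 2 * min x (min y z) ∈ X)) := by
  constructor
  · intro hW
    refine ⟨fun x hx y hy => add_mem_of_W hn hX hW hx hy, fun x hx y hy z hz => ?_⟩
    rcases le_total y z with h | h
    · rw [min_eq_left h]
      rcases le_total x y with h' | h'
      · rw [min_eq_left h']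
        convert pinwheel_mem_of_W hn hX hW hy hz hx h' (h'.trans h) using 1; ring
      · rw [min_eq_right h']
        convert pinwheel_mem_of_W hn hX hW hx hz hy h' h using 1; ring
    · rw [min_eq_right h]
      rcases le_total x z with h' | h'
      · rw [min_eq_left h']
        convert pinwheel_mem_of_W hn hX hW hy hz hx (h'.trans h) h' using 1; ring
      · rw [min_eq_right h']
        convert pinwheel_mem_of_W hn hX hW hx hy hz h' h using 1; ring
  · rintro ⟨hadd, htri⟩
    exact propertyW_of_closed hX hadd htri
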